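/- arXiv:2106.02309 — 3 statements merged into one kernel-verified Lean document; each statement's English description precedes it below -/
import Mathlib

section
/- Let B be a DFA. Then there exists a finite partition V of Pref(L(B)) whose elements are convex in (Pref(L(B)), ≼) and entangled in B. -/
/-- A deterministic finite automaton with a (possibly partial) transition function,
a unique initial state and a set of final states. -/
structure PDFA (α : Type*) (σ : Type*) where
  step : σ → α → Option σ
  start : σ
  accept : Set σ

namespace PDFA

variable {α : Type*} {σ : Type*}

/-- The transition function extended to strings (read left to right). -/
def evalFrom (M : PDFA α σ) : σ → List α → Option σ
  | q, [] => some q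
  | q, a :: w =>
    match M.step q a with
    | none => none
    | some q' => M.evalFrom q' w

/-- `δ(s, w)`. -/
def eval (M : PDFA α σ) (w : List α) : Option σ :=
  M.evalFrom M.start w

/-- The language accepted by the automaton. -/
def language (M : PDFA α σ) : Set (List α) :=
  {w | ∃ q, M.eval w = some q ∧ q ∈ M.accept}

/-- `Pref(L(M))`: the set of prefixes of accepted words. -/
def prefLang (M : PDFA α σ) : Set (List α) :=
  {w | ∃ v, w ++ v ∈ M.language}

/-- `I_q`: the words of `Pref(L(M))` reaching state `q`. -/
def I (M : PDFA α σ) (q : σ) : Set (List α) :=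
  {w | w ∈ M.prefLang ∧ M.eval w = some q}

/-- Every state is reachable from the initial state, and from every state a final
state can be reached. -/
def Trim (M : PDFA α σ) : Prop :=
  (∀ q : σ, ∃ w : List α, M.eval w = some q) ∧
  (∀ q : σ, ∃ w : List α, ∃ q' : σ, M.evalFrom q w = some q' ∧ q' ∈ M.accept)

variable [LinearOrder α]

/-- A sequence of words which is monotone (non-decreasing or non-increasing) in the
co-lexicographic order (i.e., lexicographic order of the reversed words). -/
def MonotoneColex (x : ℕ → List α) : Prop :=
  (∀ i j : ℕ, i ≤ j → (x i).reverse ≤ (x j).reverse) ∨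
  (∀ i j : ℕ, i ≤ j → (x j).reverse ≤ (x i).reverse)

/-- A set of states is entangled if a single monotone sequence of words of
`Pref(L(M))` reaches each of its states infinitely many times. -/
def EntangledStates (M : PDFA α σ) (S : Set σ) : Prop :=
  ∃ x : ℕ → List α, (∀ i, x i ∈ M.prefLang) ∧ MonotoneColex x ∧
    ∀ q ∈ S, ∀ n : ℕ, ∃ i : ℕ, n ≤ i ∧ M.eval (x i) = some q

/-- `ent(M)`: the maximum cardinality of an entangled set of states. -/
noncomputable def ent (M : PDFA α σ) [Fintype σ] : ℕ :=
  sSup {n : ℕ | ∃ S : Finset σ, S.card = n ∧ M.EntangledStates ↑S}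

/-- The strict co-lex partial order on states: `q₁ ≺ q₂` iff `q₁ ≠ q₂` and every word
reaching `q₁` is co-lexicographically smaller than every word reaching `q₂`. -/
def stateLt (M : PDFA α σ) (q₁ q₂ : σ) : Prop :=
  q₁ ≠ q₂ ∧ ∀ u ∈ M.I q₁, ∀ v ∈ M.I q₂, u.reverse < v.reverse

/-- A set of states which is an antichain for the co-lex partial order. -/
def IsColexAntichain (M : PDFA α σ) (S : Set σ) : Prop :=
  ∀ q₁ ∈ S, ∀ q₂ ∈ S, q₁ ≠ q₂ → ¬ M.stateLt q₁ q₂ ∧ ¬ M.stateLt q₂ q₁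

/-- `width(M)`: the maximum cardinality of a co-lex antichain of states. -/
noncomputable def width (M : PDFA α σ) [Fintype σ] : ℕ :=
  sSup {n : ℕ | ∃ S : Finset σ, S.card = n ∧ M.IsColexAntichain ↑S}

/-- `V` is convex in `(Pref(L(M)), ⪯)`. -/
def ConvexIn (M : PDFA α σ) (V : Set (List α)) : Prop :=
  ∀ ⦃u v w : List α⦄, u ∈ V → w ∈ V → v ∈ M.prefLang →
    u.reverse ≤ v.reverse → v.reverse ≤ w.reverse → v ∈ V

/-- A set of words `V` is entangled in `M` if some monotone sequence of elements of `V`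
passes through each state occurring in `V` infinitely many times. -/
def EntangledWords (M : PDFA α σ) (V : Set (List α)) : Prop :=
  ∃ x : ℕ → List α, (∀ i, x i ∈ V) ∧ MonotoneColex x ∧
    ∀ q : σ, (∃ w ∈ V, M.eval w = some q) →
      ∀ n : ℕ, ∃ i : ℕ, n ≤ i ∧ M.eval (x i) = some q

/-- An entangled convex (e.c.) decomposition of `M`: a partition of `Pref(L(M))` into
convex, entangled sets. -/
def IsECD (M : PDFA α σ) (V : Set (Set (List α))) : Prop :=
  (⋃₀ V) = M.prefLang ∧ V.Pairwise Disjoint ∧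
    ∀ W ∈ V, M.ConvexIn W ∧ M.EntangledWords W

/-- A minimum-size e.c. decomposition: a finite e.c. decomposition of minimum cardinality. -/
def IsMinECD (M : PDFA α σ) (V : Set (Set (List α))) : Prop :=
  V.Finite ∧ M.IsECD V ∧
    ∀ V' : Set (Set (List α)), V'.Finite → M.IsECD V' → V.ncard ≤ V'.ncard

/-- The equivalence relation `∼_𝒱`: two words are equivalent iff they reach the same state
and every element of `𝒱` lying strictly co-lexicographically between them intersects `I_q`. -/
def simV (M : PDFA α σ) (V : Set (Set (List α))) (u v : List α) : Prop :=
  M.eval u = M.eval v ∧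
  ∀ W ∈ V,
    (∀ w ∈ W, min u.reverse v.reverse < w.reverse ∧ w.reverse < max u.reverse v.reverse) →
    ∃ w ∈ W, M.eval w = M.eval u

/-- The decomposition-free characterization of `∼`: the two words reach the same state and
the co-lex interval between them is covered by finitely many convex sets, each entangled in
`M` and intersecting `I_q`. -/
def simR (M : PDFA α σ) (u v : List α) : Prop :=
  M.eval u = M.eval v ∧
  ∃ (n : ℕ) (C : Fin n → Set (List α)),
    (∀ i, C i ⊆ M.prefLang ∧ M.ConvexIn (C i) ∧ M.EntangledWords (C i) ∧
      ∃ w ∈ C i, M.eval w = M.eval u) ∧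
    ∀ w ∈ M.prefLang,
      min u.reverse v.reverse ≤ w.reverse → w.reverse ≤ max u.reverse v.reverse →
      w ∈ ⋃ i, C i

end PDFA

section ColoredLinearOrder

variable {P κ : Type*} [LinearOrder P]

/-- A set `V` is entangled for the coloring `f` if a monotone sequence of elements of `V`
takes each color occurring in `V` infinitely many times. -/
def EntangledSet (f : P → κ) (V : Set P) : Prop :=
  ∃ x : ℕ → P, (∀ i, x i ∈ V) ∧ (Monotone x ∨ Antitone x) ∧
    ∀ p ∈ V, ∀ n : ℕ, ∃ i : ℕ, n ≤ i ∧ f (x i) = f p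

/-- `S` is a finite disjoint union of convex entangled sets. -/
def Decomposable (f : P → κ) (S : Set P) : Prop :=
  ∃ V : Set (Set P), V.Finite ∧ ⋃₀ V = S ∧ V.Pairwise Disjoint ∧
    ∀ W ∈ V, W.OrdConnected ∧ EntangledSet f W

/-- All convex subsets of `S` are decomposable. -/
def HereditarilyDecomposable (f : P → κ) (S : Set P) : Prop :=
  ∀ T ⊆ S, T.OrdConnected → Decomposable f T

theorem EntangledSet.decomposable {f : P → κ} {S : Set P} (h : EntangledSet f S)
    (hS : S.OrdConnected) : Decomposable f S :=
  ⟨{S}, Set.finite_singleton S, Set.sUnion_singleton S, Set.pairwise_singleton S _,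
    by rintro W rfl; exact ⟨hS, h⟩⟩

theorem Decomposable.of_disjoint {f : P → κ} {S T : Set P} (hS : Decomposable f S)
    (hT : Decomposable f T) (hST : Disjoint S T) : Decomposable f (S ∪ T) := by
  obtain ⟨V, hVf, rfl, hVd, hV⟩ := hS
  obtain ⟨W, hWf, rfl, hWd, hW⟩ := hT
  refine ⟨V ∪ W, hVf.union hWf, Set.sUnion_union V W, ?_, ?_⟩
  · refine Set.pairwise_union_of_symm.2 ⟨hVd, hWd, ?_⟩
    intro a ha b hb _
    exact hST.mono (Set.subset_sUnion_of_mem ha) (Set.subset_sUnion_of_mem hb)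
  · rintro X (hX | hX)
    exacts [hV X hX, hW X hX]

theorem HereditarilyDecomposable.mono {f : P → κ} {S T : Set P}
    (hT : HereditarilyDecomposable f T) (h : S ⊆ T) : HereditarilyDecomposable f S :=
  fun U hU hc => hT U (hU.trans h) hc

theorem HereditarilyDecomposable.of_cut {f : P → κ} {S L : Set P} (hL : IsLowerSet L)
    (h₁ : HereditarilyDecomposable f (S ∩ L)) (h₂ : HereditarilyDecomposable f (S ∩ Lᶜ)) :
    HereditarilyDecomposable f S := by
  intro T hT hc
  rw [← Set.inter_union_compl T L]
  exact (h₁ _ (Set.inter_subset_inter_left L hT) (hc.inter hL.ordConnected)).of_disjoint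
    (h₂ _ (Set.inter_subset_inter_left Lᶜ hT) (hc.inter hL.compl.ordConnected))
    (disjoint_compl_right.mono Set.inter_subset_right Set.inter_subset_right)

theorem exists_monotone_seq_frequently [Finite κ] {f : P → κ} {U T : Set P}
    (hU : U.Nonempty) (B : Set P → Prop) (hT : B T)
    (h : ∀ S ⊆ T, B S → ∀ c ∈ f '' U, ∃ p ∈ S, f p = c ∧
      ∃ S' ⊆ S, B S' ∧ ∀ q ∈ S', p ≤ q) :
    ∃ x : ℕ → P, (∀ i, x i ∈ T) ∧ Monotone x ∧
      ∀ p ∈ U, ∀ n : ℕ, ∃ i : ℕ, n ≤ i ∧ f (x i) = f p := by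
  have : Nonempty (f '' U) := (hU.image f).to_subtype
  obtain ⟨g, hg⟩ := exists_surjective_nat (f '' U)
  have h' : ∀ (S : {S : Set P // S ⊆ T ∧ B S}) (c : f '' U), ∃ p ∈ S.1, f p = c ∧
      ∃ S' : {S : Set P // S ⊆ T ∧ B S}, ∀ q ∈ S'.1, p ≤ q := by
    rintro ⟨S, hST, hB⟩ ⟨c, hc⟩
    obtain ⟨p, hp, hpc, S', hS', hB', hle⟩ := h S hST hB c hc
    exact ⟨p, hp, hpc, ⟨S', hS'.trans hST, hB'⟩, hle⟩
  choose p hp hpc next hnext using h'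
  let S : ℕ → {S : Set P // S ⊆ T ∧ B S} := fun n =>
    Nat.rec ⟨T, subset_rfl, hT⟩ (fun n A => next A (g n.unpair.1)) n
  refine ⟨fun n => p (S n) (g n.unpair.1), fun i => (S i).2.1 (hp _ _),
    monotone_nat_of_le_succ fun n => hnext _ _ _ (hp (S (n + 1)) _), ?_⟩
  intro q hq n
  obtain ⟨k, hk⟩ := hg ⟨f q, q, hq, rfl⟩
  exact ⟨Nat.pair k n, Nat.right_le_pair k n, by simp [hpc, hk]⟩

theorem exists_antitone_seq_frequently [Finite κ] {f : P → κ} {U T : Set P}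
    (hU : U.Nonempty) (B : Set P → Prop) (hT : B T)
    (h : ∀ S ⊆ T, B S → ∀ c ∈ f '' U, ∃ p ∈ S, f p = c ∧
      ∃ S' ⊆ S, B S' ∧ ∀ q ∈ S', q ≤ p) :
    ∃ x : ℕ → P, (∀ i, x i ∈ T) ∧ Antitone x ∧
      ∀ p ∈ U, ∀ n : ℕ, ∃ i : ℕ, n ≤ i ∧ f (x i) = f p :=
  exists_monotone_seq_frequently (P := Pᵒᵈ) hU B hT h

theorem Set.OrdConnected.decomposable [Finite κ] (f : P → κ) {U : Set P}
    (hU : U.OrdConnected) : Decomposable f U := by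
  induction hn : (f '' U).ncard using Nat.strong_induction_on generalizing U with
  | _ n ih =>
  subst hn
  by_contra hdec
  have hent : ¬ EntangledSet f U := fun h => hdec (h.decomposable hU)
  have hne : U.Nonempty := by
    by_contra hne
    rw [Set.not_nonempty_iff_eq_empty] at hne
    exact hdec ⟨∅, by simp [hne]⟩
  have hbad : ¬ HereditarilyDecomposable f U := fun h => hdec (h U subset_rfl hU)
  have hcolor : ∀ S ⊆ U, ¬ HereditarilyDecomposable f S → ∀ c ∈ f '' U, c ∈ f '' S := by
    intro S hSU hS c hc
    by_contra hcS
    refine hS fun T hT hTc => ih _ ?_ hTc rfl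
    refine Set.ncard_lt_ncard ⟨Set.image_mono (hT.trans hSU), fun hsub => ?_⟩
      (Set.toFinite _)
    exact hcS (Set.image_mono hT (hsub hc))
  by_cases hsplit : ∀ S ⊆ U, ¬ HereditarilyDecomposable f S →
      ∃ x, ¬ HereditarilyDecomposable f (S ∩ Set.Iic x) ∧
        ¬ HereditarilyDecomposable f (S ∩ Set.Ioi x)
  · obtain ⟨x, hxU, hx, hf⟩ := exists_monotone_seq_frequently (f := f) hne
      (fun S => ¬ HereditarilyDecomposable f S) hbad fun S hSU hS c hc => by
        obtain ⟨x, h₁, h₂⟩ := hsplit S hSU hS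
        obtain ⟨p, hp, hpc⟩ := hcolor _ (Set.inter_subset_left.trans hSU) h₁ c hc
        exact ⟨p, hp.1, hpc, _, Set.inter_subset_left, h₂,
          fun q hq => hp.2.trans (le_of_lt hq.2)⟩
    exact hent ⟨x, hxU, Or.inl hx, hf⟩
  push Not at hsplit
  obtain ⟨W, hWU, hW, hcut⟩ := hsplit
  have key : ∀ S x, ¬ HereditarilyDecomposable f S →
      HereditarilyDecomposable f (S ∩ Set.Iic x) →
      ¬ HereditarilyDecomposable f (S ∩ Set.Ioi x) := by
    intro S x hS h₁ h₂
    exact hS (h₁.of_cut (isLowerSet_Iic x) (by rwa [Set.compl_Iic]))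
  let L : Set P := {x | ¬ HereditarilyDecomposable f (W ∩ Set.Ioi x)}
  have hL : IsLowerSet L := fun a b hba ha hb =>
    ha (hb.mono (Set.inter_subset_inter_right W (Set.Ioi_subset_Ioi hba)))
  by_cases hWL : HereditarilyDecomposable f (W ∩ L)
  · have hWL' : ¬ HereditarilyDecomposable f (W ∩ Lᶜ) := fun h => hW (hWL.of_cut hL h)
    obtain ⟨x, hxU, hx, hf⟩ := exists_antitone_seq_frequently (f := f) hne
      (fun S => ¬ HereditarilyDecomposable f S) hWL' fun S hSW hS c hc => by
        obtain ⟨p, hp, hpc⟩ :=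
          hcolor S (hSW.trans (Set.inter_subset_left.trans hWU)) hS c hc
        refine ⟨p, hp, hpc, S ∩ Set.Iic p, Set.inter_subset_left, fun h => ?_,
          fun q hq => hq.2⟩
        exact key S p hS h ((not_not.1 (hSW hp).2).mono
          (Set.inter_subset_inter_left _ (hSW.trans Set.inter_subset_left)))
    exact hent ⟨x, fun i => hWU (hxU i).1, Or.inr hx, hf⟩
  · obtain ⟨x, hxU, hx, hf⟩ := exists_monotone_seq_frequently (f := f) hne
      (fun S => ¬ HereditarilyDecomposable f S) hWL fun S hSW hS c hc => by
        obtain ⟨p, hp, hpc⟩ :=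
          hcolor S (hSW.trans (Set.inter_subset_left.trans hWU)) hS c hc
        refine ⟨p, hp, hpc, S ∩ Set.Ioi p, Set.inter_subset_left, key S p hS ?_,
          fun q hq => le_of_lt hq.2⟩
        have hWp : HereditarilyDecomposable f (W ∩ Set.Iic p) := by
          by_contra h
          exact (hSW hp).2 (hcut p h)
        exact hWp.mono (Set.inter_subset_inter_left _ (hSW.trans Set.inter_subset_left))
    exact hent ⟨x, fun i => hWU (hxU i).1, Or.inl hx, hf⟩

end ColoredLinearOrder

/-- Theorem: every (trim) DFA admits a finite partition of `Pref(L(B))` into sets which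
are convex in the co-lex order and entangled in `B`. -/
theorem exists_finite_ec_decomposition {α σ : Type*} [LinearOrder α] [Fintype σ]
    (M : PDFA α σ) (hM : M.Trim) :
    ∃ V : Set (Set (List α)), V.Finite ∧ M.IsECD V := by
  let P := {u : List α // u.reverse ∈ M.prefLang}
  let word : P → List α := fun u => u.1.reverse
  have hword : Function.Injective word := fun u v h =>
    Subtype.ext (List.reverse_injective h)
  obtain ⟨V, hVf, hVu, hVd, hV⟩ :=
    (Set.ordConnected_univ (α := P)).decomposable fun u => M.eval (word u)
  refine ⟨(fun W => word '' W) '' V, hVf.image _, ?_, ?_, ?_⟩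
  · rw [Set.sUnion_image, ← Set.image_iUnion₂, ← Set.sUnion_eq_biUnion, hVu, Set.image_univ]
    ext w
    constructor
    · rintro ⟨u, rfl⟩
      exact u.2
    · intro hw
      exact ⟨⟨w.reverse, by simpa using hw⟩, List.reverse_reverse w⟩
  · rintro _ ⟨A, hA, rfl⟩ _ ⟨B, hB, rfl⟩ hne
    exact (Set.disjoint_image_iff hword).2 (hVd hA hB fun h => hne (by rw [h]))
  · rintro _ ⟨W, hW, rfl⟩
    obtain ⟨hc, x, hxW, hx, hf⟩ := hV W hW
    refine ⟨?_, fun i => word (x i), fun i => ⟨x i, hxW i, rfl⟩, ?_, ?_⟩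
    · rintro _ v _ ⟨a, ha, rfl⟩ ⟨b, hb, rfl⟩ hv hav hvb
      refine ⟨⟨v.reverse, by simpa using hv⟩, hc.out ha hb ⟨?_, ?_⟩, List.reverse_reverse v⟩
      · exact (by simpa [word] using hav : a.1 ≤ v.reverse)
      · exact (by simpa [word] using hvb : v.reverse ≤ b.1)
    · refine hx.imp (fun h i j hij => ?_) (fun h i j hij => ?_)
      · simpa [word] using h hij
      · simpa [word] using h hij
    · rintro q ⟨_, ⟨p, hp, rfl⟩, hq⟩ n
      obtain ⟨i, hi, hfi⟩ := hf p hp n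
      exact ⟨i, hi, hfi.trans hq⟩
end

section
/- Let A be the minimum DFA of a regular language L. Then width(L) = ent(A) = ent(L); that is, the minimum, over all DFAs B with L(B) = L, of the width of the co-lex partial order of B equals the entanglement number of the minimum DFA A, which in turn equals the minimum entanglement number over all DFAs recognizing L. -/
/-- `width(L)`: the minimum width of a (trim) DFA recognizing `L`. -/
noncomputable def langWidth {α : Type*} [LinearOrder α] (L : Set (List α)) : ℕ :=
  sInf {n : ℕ | ∃ (m : ℕ) (B : PDFA α (Fin m)), B.Trim ∧ B.language = L ∧ B.width = n}

/-- `ent(L)`: the minimum entanglement number of a (trim) DFA recognizing `L`. -/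
noncomputable def langEnt {α : Type*} [LinearOrder α] (L : Set (List α)) : ℕ :=
  sInf {n : ℕ | ∃ (m : ℕ) (B : PDFA α (Fin m)), B.Trim ∧ B.language = L ∧ B.ent = n}

/-! ### Entangled convex sets in a coloured linear order -/

namespace ColouredOrder

open Set

variable {X C : Type*}

/-- Some nonempty subset of `D` contains, beyond each of its points, all colours of `D`. -/
def Recurrent (le : X → X → Prop) (c : X → C) (D : Set X) : Prop :=
  ∃ E ⊆ D, E.Nonempty ∧ ∀ y ∈ E, ∀ z ∈ D, ∃ y' ∈ E, le y y' ∧ c y' = c z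

variable [LinearOrder X]

/-- A convex set all of whose colours recur along an upward or a downward direction. -/
structure EntConvex (c : X → C) (D : Set X) : Prop where
  ordConnected : D.OrdConnected
  recurrent : Recurrent (· ≤ ·) c D ∨ Recurrent (· ≥ ·) c D

/-- Two points of the same colour are linked if the interval between them is covered by finitely
many entangled convex sets that meet this colour. -/
def Linked (c : X → C) (u v : X) : Prop :=
  c u = c v ∧ ∃ F : Set (Set X), F.Finite ∧
    (∀ D ∈ F, EntConvex c D ∧ ∃ z ∈ D, c z = c u) ∧ uIcc u v ⊆ ⋃₀ F

variable {c : X → C}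

theorem EntConvex.singleton (c : X → C) (u : X) : EntConvex c {u} :=
  ⟨ordConnected_singleton, Or.inl ⟨{u}, subset_rfl, singleton_nonempty u, by simp⟩⟩

theorem EntConvex.linked {D : Set X} (hD : EntConvex c D) {u v : X} (hu : u ∈ D) (hv : v ∈ D)
    (h : c u = c v) : Linked c u v :=
  ⟨h, {D}, finite_singleton D, by rintro _ rfl; exact ⟨hD, u, hu, rfl⟩,
    by simpa using hD.ordConnected.uIcc_subset hu hv⟩

theorem Linked.refl (c : X → C) (u : X) : Linked c u u :=
  (EntConvex.singleton c u).linked rfl rfl rfl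

theorem Linked.symm {u v : X} : Linked c u v → Linked c v u := by
  rintro ⟨h, F, hF, hD, hs⟩
  exact ⟨h.symm, F, hF, h ▸ hD, uIcc_comm u v ▸ hs⟩

theorem Linked.trans {u v w : X} : Linked c u v → Linked c v w → Linked c u w := by
  rintro ⟨h, F, hF, hD, hs⟩ ⟨h', F', hF', hD', hs'⟩
  refine ⟨h.trans h', F ∪ F', hF.union hF', ?_, ?_⟩
  · rintro D (hDF | hDF)
    · exact hD D hDF
    · exact h ▸ hD' D hDF
  · rw [sUnion_union]
    exact uIcc_subset_uIcc_union_uIcc.trans (union_subset_union hs hs')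

theorem Linked.of_mem_uIcc {u v x : X} (h : Linked c u v) (hx : x ∈ uIcc u v) (hc : c x = c u) :
    Linked c u x := by
  obtain ⟨-, F, hF, hD, hs⟩ := h
  exact ⟨hc.symm, F, hF, hD, (uIcc_subset_uIcc_left hx).trans hs⟩

theorem Linked.of_dual {u v : X} (h : Linked (X := Xᵒᵈ) c u v) : Linked c u v := by
  obtain ⟨h, F, hF, hD, hs⟩ := h
  refine ⟨h, F, hF, fun D hDF => ⟨⟨?_, (hD D hDF).1.recurrent.symm⟩, (hD D hDF).2⟩, ?_⟩
  · exact ⟨fun x hx y hy z hz => (hD D hDF).1.ordConnected.out hy hx ⟨hz.2, hz.1⟩⟩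
  · intro x hx
    rw [mem_uIcc] at hx
    refine hs ((mem_uIcc (α := Xᵒᵈ)).2 ?_)
    rcases hx with hx | hx
    · exact Or.inr ⟨hx.2, hx.1⟩
    · exact Or.inl ⟨hx.2, hx.1⟩

/-- The setoid of linked points. -/
def linkedSetoid (c : X → C) : Setoid X :=
  ⟨Linked c, Linked.refl c, Linked.symm, Linked.trans⟩

theorem exists_linked_succ [Finite C] {u : ℕ → X} (hu : Monotone u)
    (hc : ∀ m n, c (u m) = c (u n)) : ∃ n, Linked c (u n) (u (n + 1)) := by
  let T : ℕ → Set X := fun n => {x | u n ≤ x ∧ ∃ k, x ≤ u k}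
  have hT : Antitone T := fun m n hmn x hx => ⟨(hu hmn).trans hx.1, hx.2⟩
  let f : ℕ →o (Set C)ᵒᵈ :=
    ⟨fun n => OrderDual.toDual (c '' T n), fun m n hmn => image_mono (hT hmn)⟩
  obtain ⟨N, hN⟩ := WellFoundedGT.monotone_chain_condition f
  have hN' : ∀ m, N ≤ m → c '' T N = c '' T m := hN
  refine ⟨N, EntConvex.linked (D := T N) ⟨?_, Or.inl ⟨T N, subset_rfl, ⟨u N, le_rfl, N, le_rfl⟩, ?_⟩⟩
    ⟨le_rfl, N, le_rfl⟩ ⟨hu N.le_succ, N + 1, le_rfl⟩ (hc _ _)⟩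
  · refine ⟨fun x hx y hy z hz => ⟨hx.1.trans hz.1, ?_⟩⟩
    obtain ⟨k, hk⟩ := hy.2
    exact ⟨k, hz.2.trans hk⟩
  · rintro y ⟨hy, k, hk⟩ z hz
    have hz' : c z ∈ c '' T (max N k) := hN' _ (le_max_left N k) ▸ mem_image_of_mem c hz
    obtain ⟨y', hy', hcy⟩ := hz'
    exact ⟨y', hT (le_max_left N k) hy', hk.trans ((hu (le_max_right N k)).trans hy'.1), hcy⟩

theorem finite_quotient_linked [Finite C] (c : X → C) : Finite (Quotient (linkedSetoid c)) := by
  by_contra hfin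
  rw [not_finite_iff_infinite] at hfin
  obtain ⟨q, hq⟩ := Finite.exists_infinite_fiber
    (fun x : Quotient (linkedSetoid c) => c x.out)
  let e := Infinite.natEmbedding ((fun x : Quotient (linkedSetoid c) => c x.out) ⁻¹' {q})
  let u : ℕ → X := fun n => (e n).1.out
  have hc : ∀ m n, c (u m) = c (u n) := fun m n => (e m).2.trans (e n).2.symm
  have hne : ∀ m n, m ≠ n → ¬ Linked c (u m) (u n) := by
    intro m n hmn h
    refine hmn (e.injective (Subtype.ext ?_))
    rw [← Quotient.out_eq (e m).1, ← Quotient.out_eq (e n).1]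
    exact Quotient.sound h
  obtain ⟨g, hg | hg⟩ := exists_increasing_or_nonincreasing_subseq (· ≤ ·) u
  · obtain ⟨n, hn⟩ := exists_linked_succ (c := c) (u := u ∘ g)
      (monotone_nat_of_le_succ fun n => hg _ _ n.lt_succ_self) (fun m n => hc _ _)
    exact hne _ _ (g.injective.ne n.succ_ne_self.symm) hn
  · obtain ⟨n, hn⟩ := exists_linked_succ (X := Xᵒᵈ) (c := c) (u := u ∘ g)
      (monotone_nat_of_le_succ fun n => (not_le.1 (hg _ _ n.lt_succ_self)).le) (fun m n => hc _ _)
    exact hne _ _ (g.injective.ne n.succ_ne_self.symm) (Linked.of_dual hn)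

/-- Points of the same colour whose classes interleave are linked. -/
theorem linked_of_interleaved {u u' v v' : X} (hu : Linked c u u') (hv : Linked c v v')
    (hc : c u = c v) (h : v ≤ u) (h' : u' ≤ v') : Linked c u v := by
  rcases le_total u' v with h1 | h1
  · exact hu.of_mem_uIcc (mem_uIcc.2 (Or.inr ⟨h1, h⟩)) hc.symm
  · exact hu.trans (hv.of_mem_uIcc (mem_uIcc.2 (Or.inl ⟨h1, h'⟩)) (hu.1.symm.trans hc)).symm

/-- One-dimensional Helly property for pairwise interleaved classes. -/
theorem exists_common_point {ι : Type*} [Finite ι] [Nonempty ι] {K : ι → Set X}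
    (hK : ∀ i j, ∃ u ∈ K i, ∃ v ∈ K j, v ≤ u) :
    ∃ w, ∀ j, ∃ z ∈ K j, ∃ z' ∈ K j, z ≤ w ∧ w ≤ z' := by
  choose u hu v hv hvu using hK
  have hlow : ∀ j, ∃ i, ∀ i', v i j ≤ v i' j := fun j => Finite.exists_min (fun i => v i j)
  have hupp : ∀ i, ∃ j, ∀ j', u i j' ≤ u i j := fun i => Finite.exists_max (u i)
  choose l hl using hlow
  choose m hm using hupp
  obtain ⟨k, hk⟩ := Finite.exists_max (fun j => v (l j) j)
  exact ⟨v (l k) k, fun j => ⟨v (l j) j, hv _ _, u j (m j), hu _ _, hk j,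
    (hl k j).trans ((hvu j k).trans (hm j k))⟩⟩

theorem exists_cofinal_of_cover {E : Set X} (hE : E.Nonempty) {F : Set (Set X)} (hF : F.Finite)
    (hs : E ⊆ ⋃₀ F) : ∃ D ∈ F, ∀ e ∈ E, ∃ e' ∈ E ∩ D, e ≤ e' := by
  by_contra! h
  obtain ⟨e, he⟩ := hE
  have : Nonempty X := ⟨e⟩
  choose! g hgE hg using h
  obtain ⟨D, hD, -⟩ := hs he
  obtain ⟨D₁, hD₁, hmax⟩ := exists_max_image F g hF ⟨D, hD⟩
  obtain ⟨D₂, hD₂, hmem⟩ := hs (hgE D₁ hD₁)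
  exact absurd (hmax D₂ hD₂) (not_le.2 (hg D₂ hD₂ _ ⟨hgE D₁ hD₁, hmem⟩))

theorem exists_colour_superset_of_recurrent {D : Set X} (hD : Recurrent (· ≤ ·) c D)
    {F : Set (Set X)} (hF : F.Finite) (hs : D ⊆ ⋃₀ F) (hconv : ∀ D' ∈ F, D'.OrdConnected) :
    ∃ D' ∈ F, ∀ z ∈ D, ∃ y ∈ D ∩ D', c y = c z := by
  obtain ⟨E, hED, hne, hE⟩ := hD
  obtain ⟨D', hD', hcof⟩ := exists_cofinal_of_cover hne hF (hED.trans hs)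
  refine ⟨D', hD', fun z hz => ?_⟩
  obtain ⟨e, he⟩ := hne
  obtain ⟨e₀, ⟨he₀, he₀'⟩, -⟩ := hcof e he
  obtain ⟨y, hy, hle, hcy⟩ := hE e₀ he₀ z hz
  obtain ⟨e₁, ⟨-, he₁'⟩, hle'⟩ := hcof y hy
  exact ⟨y, ⟨hED hy, (hconv D' hD').out he₀' he₁' ⟨hle, hle'⟩⟩, hcy⟩

theorem EntConvex.exists_colour_superset {D : Set X} (hD : EntConvex c D)
    {F : Set (Set X)} (hF : F.Finite) (hs : D ⊆ ⋃₀ F) (hconv : ∀ D' ∈ F, D'.OrdConnected) :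
    ∃ D' ∈ F, ∀ z ∈ D, ∃ y ∈ D ∩ D', c y = c z := by
  rcases hD.recurrent with h | h
  · exact exists_colour_superset_of_recurrent h hF hs hconv
  · exact exists_colour_superset_of_recurrent (X := Xᵒᵈ) h hF hs
      (fun D' hD' => (hconv D' hD').dual)

/-- An entangled convex set meeting the convex hull of every class `r j` can be replaced by one
that meets the colour of every `r j`. -/
theorem exists_entConvex_of_mem_hulls [Finite C] {ι : Type*} (r : ι → X) {D : Set X}
    (hD : EntConvex c D)
    (hr : ∀ j, ∃ w ∈ D, ∃ z z', Linked c (r j) z ∧ Linked c (r j) z' ∧ z ≤ w ∧ w ≤ z') :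
    ∃ D', EntConvex c D' ∧ ∀ j, ∃ z ∈ D', c z = c (r j) := by
  induction hS : c '' D using WellFoundedGT.induction generalizing D with
  | ind S ih =>
    by_cases hall : ∀ j, ∃ z ∈ D, c z = c (r j)
    · exact ⟨D, hD, hall⟩
    push Not at hall
    obtain ⟨j, hj⟩ := hall
    have hdich : ∀ i, (∃ d ∈ D, Linked c (r i) d) ∨
        ∃ z z', Linked c (r i) z ∧ Linked c (r i) z' ∧ D ⊆ Icc z z' := by
      intro i
      obtain ⟨w, hw, z, z', hz, hz', h1, h2⟩ := hr i
      by_cases hzD : z ∈ D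
      · exact Or.inl ⟨z, hzD, hz⟩
      by_cases hzD' : z' ∈ D
      · exact Or.inl ⟨z', hzD', hz'⟩
      refine Or.inr ⟨z, z', hz, hz', fun d hd => ⟨?_, ?_⟩⟩
      · by_contra! hlt
        exact hzD (hD.ordConnected.out hd hw ⟨hlt.le, h1⟩)
      · by_contra! hlt
        exact hzD' (hD.ordConnected.out hw hd ⟨h2, hlt.le⟩)
    obtain ⟨d, hd, hjd⟩ | ⟨z, z', hz, hz', hsub⟩ := hdich j
    · exact absurd hjd.1.symm (hj d hd)
    obtain ⟨-, F, hF, hDF, hcov⟩ := hz.symm.trans hz'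
    obtain ⟨D', hD'F, hD'⟩ := hD.exists_colour_superset hF
      ((hsub.trans Icc_subset_uIcc).trans hcov) (fun D' h => (hDF D' h).1.ordConnected)
    obtain ⟨hent, x, hx, hcx⟩ := hDF D' hD'F
    have hle : c '' D ⊆ c '' D' := by
      rintro _ ⟨z, hz, rfl⟩
      obtain ⟨y, hy, hyz⟩ := hD' z hz
      exact ⟨y, hy.2, hyz⟩
    have hlt : S < c '' D' := by
      rw [← hS]
      refine ⟨hle, fun hge => ?_⟩
      obtain ⟨d, hd, hdx⟩ := hge (mem_image_of_mem c hx)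
      exact hj d hd (hdx.trans (hcx.trans hz.1.symm))
    refine ih _ hlt hent (fun i => ?_) rfl
    obtain ⟨d, hd, hid⟩ | ⟨z, z', hz, hz', hsub⟩ := hdich i
    · obtain ⟨y, hy, hyd⟩ := hD' d hd
      have hiy := hid.trans (hD.linked hd hy.1 hyd.symm)
      exact ⟨y, hy.2, y, y, hiy, hiy, le_rfl, le_rfl⟩
    · obtain ⟨w, hw, -⟩ := hr i
      obtain ⟨y, hy, -⟩ := hD' w hw
      exact ⟨y, hy.2, z, z', hz, hz', hsub hy.1⟩

theorem Recurrent.exists_monotone [Finite C] {D : Set X} (hD : Recurrent (· ≤ ·) c D) :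
    ∃ x : ℕ → X, Monotone x ∧ ∀ z ∈ D, ∀ n, ∃ i, n ≤ i ∧ c (x i) = c z := by
  obtain ⟨E, hED, ⟨e, he⟩, hE⟩ := hD
  have : Nonempty (c '' D) := ⟨⟨c e, e, hED he, rfl⟩⟩
  obtain ⟨h, hh⟩ := exists_surjective_nat (c '' D)
  have hnext : ∀ (y : E) (q : c '' D), ∃ y' : E, y.1 ≤ y'.1 ∧ c y'.1 = q.1 := by
    rintro ⟨y, hy⟩ ⟨_, z, hz, rfl⟩
    obtain ⟨y', hy', h1, h2⟩ := hE y hy z hz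
    exact ⟨⟨y', hy'⟩, h1, h2⟩
  choose next hle hcol using hnext
  let x : ℕ → E := Nat.rec ⟨e, he⟩ fun n y => next y (h n.unpair.1)
  refine ⟨fun n => (x n).1, monotone_nat_of_le_succ fun n => hle _ _, fun z hz n => ?_⟩
  obtain ⟨k, hk⟩ := hh ⟨c z, z, hz, rfl⟩
  refine ⟨Nat.pair k n + 1, (Nat.right_le_pair k n).trans (Nat.le_succ _), ?_⟩
  refine (hcol _ _).trans ?_
  rw [Nat.unpair_pair, hk]

theorem EntConvex.exists_sequence [Finite C] {D : Set X} (hD : EntConvex c D) :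
    ∃ x : ℕ → X, (Monotone x ∨ Antitone x) ∧ ∀ z ∈ D, ∀ n, ∃ i, n ≤ i ∧ c (x i) = c z := by
  rcases hD.recurrent with h | h
  · obtain ⟨x, hx, hvisit⟩ := h.exists_monotone
    exact ⟨x, Or.inl hx, hvisit⟩
  · obtain ⟨x, hx, hvisit⟩ := Recurrent.exists_monotone (X := Xᵒᵈ) h
    exact ⟨x, Or.inr hx, hvisit⟩

/-- A finite family of pairwise interleaved classes has its colours visited infinitely often by
a single monotone sequence. -/
theorem exists_sequence_of_interleaved [Finite C] {ι : Type*} [Finite ι] [Nonempty ι] (r : ι → X)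
    (hr : ∀ i j, ∃ u, Linked c (r i) u ∧ ∃ v, Linked c (r j) v ∧ v ≤ u) :
    ∃ x : ℕ → X, (Monotone x ∨ Antitone x) ∧ ∀ j, ∀ n, ∃ i, n ≤ i ∧ c (x i) = c (r j) := by
  obtain ⟨w, hw⟩ := exists_common_point (K := fun j => {u | Linked c (r j) u}) hr
  obtain ⟨D, hD, hDr⟩ := exists_entConvex_of_mem_hulls r (EntConvex.singleton c w) fun j => by
    obtain ⟨z, hz, z', hz', h⟩ := hw j
    exact ⟨w, rfl, z, z', hz, hz', h⟩
  obtain ⟨x, hx, hx'⟩ := hD.exists_sequence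
  refine ⟨x, hx, fun j n => ?_⟩
  obtain ⟨z, hz, hzj⟩ := hDr j
  exact hzj ▸ hx' z hz n

end ColouredOrder

namespace PDFA

variable {α σ τ : Type*}

theorem evalFrom_append (M : PDFA α σ) (q : σ) (u v : List α) :
    M.evalFrom q (u ++ v) = (M.evalFrom q u).bind fun p => M.evalFrom p v := by
  induction u generalizing q with
  | nil => rfl
  | cons a u ih =>
    simp only [List.cons_append, evalFrom]
    cases M.step q a with
    | none => rfl
    | some p => exact ih p

theorem eval_append (M : PDFA α σ) (u v : List α) :
    M.eval (u ++ v) = (M.eval u).bind fun p => M.evalFrom p v :=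
  M.evalFrom_append _ u v

theorem eval_concat (M : PDFA α σ) (u : List α) (a : α) :
    M.eval (u ++ [a]) = (M.eval u).bind fun p => M.step p a := by
  rw [eval_append]
  congr 1
  funext p
  simp only [evalFrom]
  cases M.step p a <;> rfl

theorem prefLang_of_append {M : PDFA α σ} {u v : List α} (h : u ++ v ∈ M.prefLang) :
    u ∈ M.prefLang := by
  obtain ⟨w, hw⟩ := h
  exact ⟨v ++ w, by rwa [← List.append_assoc]⟩

theorem prefLang_congr {M : PDFA α σ} {N : PDFA α τ} (h : M.language = N.language) :
    M.prefLang = N.prefLang := by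
  simp only [prefLang, h]

theorem exists_eval_of_mem_prefLang {M : PDFA α σ} {u : List α} (h : u ∈ M.prefLang) :
    ∃ q, M.eval u = some q := by
  obtain ⟨v, q, hq, -⟩ := h
  rw [eval_append] at hq
  obtain ⟨p, hp, -⟩ := Option.bind_eq_some_iff.1 hq
  exact ⟨p, hp⟩

theorem Trim.mem_prefLang {M : PDFA α σ} (hM : M.Trim) {u : List α} {q : σ}
    (h : M.eval u = some q) : u ∈ M.prefLang := by
  obtain ⟨w, q', hw, hq'⟩ := hM.2 q
  exact ⟨w, q', by rw [eval_append, h]; exact hw, hq'⟩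

theorem Trim.mem_prefLang_congr {M : PDFA α σ} (hM : M.Trim) {u v : List α}
    (h : M.eval u = M.eval v) (hu : u ∈ M.prefLang) : v ∈ M.prefLang := by
  obtain ⟨q, hq⟩ := exists_eval_of_mem_prefLang hu
  exact hM.mem_prefLang (h ▸ hq)

theorem mem_language_congr {M : PDFA α σ} {u v : List α} (h : M.eval u = M.eval v)
    (w : List α) : u ++ w ∈ M.language ↔ v ++ w ∈ M.language := by
  simp only [language, Set.mem_ofPred_eq, eval_append, h]

/-- A right-invariant labelling of the prefixes that respects acceptance yields an automaton whose
states are the labels. -/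
theorem exists_of_labelling (M : PDFA α σ) (h0 : [] ∈ M.prefLang) (f : M.prefLang → τ)
    (hf : Function.Surjective f)
    (hacc : ∀ u v, f u = f v → u.1 ∈ M.language → v.1 ∈ M.language)
    (hstep : ∀ u v, f u = f v → ∀ a, ∀ hu : u.1 ++ [a] ∈ M.prefLang,
      ∃ hv : v.1 ++ [a] ∈ M.prefLang, f ⟨_, hu⟩ = f ⟨_, hv⟩) :
    ∃ B : PDFA α τ, B.Trim ∧ B.language = M.language ∧
      ∀ w q, B.eval w = some q ↔ ∃ h : w ∈ M.prefLang, f ⟨w, h⟩ = q := by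
  classical
  choose g hg using hf
  let B : PDFA α τ :=
    { step := fun q a => if h : (g q).1 ++ [a] ∈ M.prefLang then some (f ⟨_, h⟩) else none
      start := f ⟨[], h0⟩
      accept := {q | (g q).1 ∈ M.language} }
  have heval : ∀ w q, B.eval w = some q ↔ ∃ h : w ∈ M.prefLang, f ⟨w, h⟩ = q := by
    intro w
    induction w using List.reverseRecOn with
    | nil =>
      intro q
      change some (f ⟨[], h0⟩) = some q ↔ _
      simp [h0]
    | append_singleton w a ih =>
      intro q
      rw [eval_concat, Option.bind_eq_some_iff]
      constructor
      · rintro ⟨p, hp, hq⟩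
        obtain ⟨hw, hwp⟩ := (ih p).1 hp
        by_cases h : (g p).1 ++ [a] ∈ M.prefLang
        · simp only [B, dif_pos h, Option.some.injEq] at hq
          obtain ⟨hv, hv'⟩ := hstep (g p) ⟨w, hw⟩ ((hg p).trans hwp.symm) a h
          exact ⟨hv, hv'.symm.trans hq⟩
        · simp [B, dif_neg h] at hq
      · rintro ⟨h, hq⟩
        have hw := prefLang_of_append h
        refine ⟨f ⟨w, hw⟩, (ih _).2 ⟨hw, rfl⟩, ?_⟩
        obtain ⟨hv, hv'⟩ := hstep ⟨w, hw⟩ (g (f ⟨w, hw⟩)) (hg _).symm a h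
        simp only [B, dif_pos hv, ← hv', hq]
  have hlang : B.language = M.language := by
    ext w
    constructor
    · rintro ⟨q, hq, hqa⟩
      obtain ⟨hw, rfl⟩ := (heval w q).1 hq
      exact hacc _ ⟨w, hw⟩ (hg _) hqa
    · intro hw
      have hw' : w ∈ M.prefLang := ⟨[], by simpa using hw⟩
      exact ⟨_, (heval w _).2 ⟨hw', rfl⟩, hacc ⟨w, hw'⟩ _ (hg _).symm hw⟩
  refine ⟨B, ⟨fun q => ⟨g q, (heval _ q).2 ⟨(g q).2, hg q⟩⟩, fun q => ?_⟩, hlang, heval⟩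
  obtain ⟨v, hv⟩ := (g q).2
  rw [← hlang] at hv
  obtain ⟨q', hq', hacc'⟩ := hv
  rw [eval_append, (heval _ q).2 ⟨(g q).2, hg q⟩] at hq'
  exact ⟨v, q', hq', hacc'⟩

theorem Trim.nil_mem_prefLang {M : PDFA α σ} (hM : M.Trim) : [] ∈ M.prefLang :=
  hM.mem_prefLang (q := M.start) rfl

/-- In a trim automaton with the least number of states, words with the same right language reach
the same state. -/
theorem Trim.eval_eq_of_minimum [Fintype σ] {A : PDFA α σ} (hA : A.Trim)
    (hmin : ∀ (m : ℕ) (D : PDFA α (Fin m)), D.Trim → D.language = A.language →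
      Fintype.card σ ≤ m)
    {u v : List α} (hu : u ∈ A.prefLang) (hv : v ∈ A.prefLang)
    (h : ∀ w, u ++ w ∈ A.language ↔ v ++ w ∈ A.language) : A.eval u = A.eval v := by
  classical
  let s : Setoid A.prefLang :=
    ⟨fun x y => ∀ w, x.1 ++ w ∈ A.language ↔ y.1 ++ w ∈ A.language,
      fun _ _ => Iff.rfl, fun h w => (h w).symm, fun h h' w => (h w).trans (h' w)⟩
  choose word hword using hA.1
  let rep : σ → A.prefLang := fun q => ⟨word q, hA.mem_prefLang (hword q)⟩
  let k : σ → Quotient s := fun q => Quotient.mk s (rep q)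
  have hk : ∀ (x : A.prefLang) (q : σ), A.eval x.1 = some q → k q = Quotient.mk s x := by
    intro x q hq
    exact Quotient.sound fun w => mem_language_congr ((hword q).trans hq.symm) w
  have hsurj : Function.Surjective k := by
    intro y
    induction y using Quotient.inductionOn with
    | h x =>
      obtain ⟨q, hq⟩ := exists_eval_of_mem_prefLang x.2
      exact ⟨q, hk x q hq⟩
  have : Finite (Quotient s) := Finite.of_surjective k hsurj
  let e := Finite.equivFin (Quotient s)
  obtain ⟨B, hB, hBL, -⟩ := A.exists_of_labelling hA.nil_mem_prefLang
    (fun x => e (Quotient.mk s x)) (e.surjective.comp Quotient.mk_surjective)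
    (by
      intro x y hxy hx
      have := (Quotient.exact (e.injective hxy) : ∀ w, _) []
      simpa using this.1 (by simpa using hx))
    (by
      intro x y hxy a hx
      have hr : ∀ w, x.1 ++ w ∈ A.language ↔ y.1 ++ w ∈ A.language :=
        Quotient.exact (e.injective hxy)
      have hr' : ∀ w, (x.1 ++ [a]) ++ w ∈ A.language ↔ (y.1 ++ [a]) ++ w ∈ A.language := by
        intro w
        rw [List.append_assoc, List.append_assoc]
        exact hr _
      obtain ⟨w, hw⟩ := hx
      exact ⟨⟨w, (hr' w).1 hw⟩, congrArg e (Quotient.sound hr')⟩)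
  have hcard := hmin _ B hB hBL
  have hinj : Function.Injective k := by
    have hbij : Function.Bijective k := by
      rw [Nat.bijective_iff_surjective_and_card]
      refine ⟨hsurj, le_antisymm ?_ (Nat.card_le_card_of_surjective k hsurj)⟩
      rwa [Nat.card_eq_fintype_card]
    exact hbij.1
  obtain ⟨p, hp⟩ := exists_eval_of_mem_prefLang hu
  obtain ⟨q, hq⟩ := exists_eval_of_mem_prefLang hv
  have hpq : k p = k q := by
    rw [hk ⟨u, hu⟩ p hp, hk ⟨v, hv⟩ q hq]
    exact Quotient.sound h
  rw [hp, hq, hinj hpq]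

/-- The reversed prefixes of the language, ordered lexicographically. -/
abbrev RevPref (M : PDFA α σ) : Type _ := {r : List α // r.reverse ∈ M.prefLang}

/-- The state reached by a reversed prefix. -/
def colour (M : PDFA α σ) (r : M.RevPref) : Option σ := M.eval r.1.reverse

/-- The reversed prefix of a prefix. -/
def toRev (M : PDFA α σ) (w : M.prefLang) : M.RevPref := ⟨w.1.reverse, by simp [w.2]⟩

theorem colour_toRev (M : PDFA α σ) (w : M.prefLang) : M.colour (M.toRev w) = M.eval w.1 := by
  simp [colour, toRev]

theorem colour_cons {M : PDFA α σ} {a : α} {x y : M.RevPref} (h : M.colour x = M.colour y)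
    (hx : (a :: x.1).reverse ∈ M.prefLang) (hy : (a :: y.1).reverse ∈ M.prefLang) :
    M.colour ⟨a :: x.1, hx⟩ = M.colour ⟨a :: y.1, hy⟩ := by
  simp only [colour, List.reverse_cons, eval_concat] at h ⊢
  rw [h]

theorem Trim.cons_mem_prefLang {M : PDFA α σ} (hM : M.Trim) {a : α} {x y : M.RevPref}
    (h : M.colour x = M.colour y) (hx : (a :: x.1).reverse ∈ M.prefLang) :
    (a :: y.1).reverse ∈ M.prefLang := by
  refine hM.mem_prefLang_congr ?_ hx
  simp only [colour, List.reverse_cons, eval_concat] at h ⊢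
  rw [h]

open ColouredOrder

/-- The reversed prefixes obtained from `D` by appending the letter `a`. -/
def consImage (M : PDFA α σ) (a : α) (D : Set M.RevPref) : Set M.RevPref :=
  {y | ∃ x ∈ D, y.1 = a :: x.1}

theorem Trim.recurrent_consImage {M : PDFA α σ} (hM : M.Trim) {a : α} {D : Set M.RevPref}
    (hne : (M.consImage a D).Nonempty) {le : M.RevPref → M.RevPref → Prop}
    (hle : ∀ x x' y y' : M.RevPref, y.1 = a :: x.1 → y'.1 = a :: x'.1 → le x x' → le y y')
    (hD : Recurrent le M.colour D) : Recurrent le M.colour (M.consImage a D) := by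
  obtain ⟨E, hED, hEne, hE⟩ := hD
  have key : ∀ e ∈ E, ∀ z ∈ M.consImage a D, ∃ e' ∈ E, le e e' ∧
      ∃ y : M.RevPref, y.1 = a :: e'.1 ∧ M.colour y = M.colour z := by
    rintro e he ⟨z, hz⟩ ⟨d, hd, rfl⟩
    obtain ⟨e', he', h1, h2⟩ := hE e he d hd
    have h3 := hM.cons_mem_prefLang h2.symm hz
    exact ⟨e', he', h1, ⟨_, h3⟩, rfl, colour_cons h2 h3 hz⟩
  refine ⟨M.consImage a E, fun y ⟨x, hx, h⟩ => ⟨x, hED hx, h⟩, ?_, ?_⟩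
  · obtain ⟨e, he⟩ := hEne
    obtain ⟨z, hz⟩ := hne
    obtain ⟨e', he', -, y, hy, -⟩ := key e he z hz
    exact ⟨y, e', he', hy⟩
  · rintro y ⟨e, he, hy⟩ z hz
    obtain ⟨e', he', h1, y', hy', hc⟩ := key e he z hz
    exact ⟨y', ⟨e', he', hy'⟩, hle _ _ _ _ hy hy' h1, hc⟩

variable [LinearOrder α]

theorem bddAbove_card [Fintype σ] (P : Finset σ → Prop) :
    BddAbove {n : ℕ | ∃ S : Finset σ, S.card = n ∧ P S} :=
  ⟨Fintype.card σ, by rintro _ ⟨S, rfl, -⟩; exact S.card_le_univ⟩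

theorem card_le_ent (M : PDFA α σ) [Fintype σ] {S : Finset σ} (h : M.EntangledStates ↑S) :
    S.card ≤ M.ent :=
  le_csSup (bddAbove_card fun S : Finset σ => M.EntangledStates ↑S) ⟨S, rfl, h⟩

theorem ent_le (M : PDFA α σ) [Fintype σ] {n : ℕ}
    (h : ∀ S : Finset σ, M.EntangledStates ↑S → S.card ≤ n) : M.ent ≤ n :=
  csSup_le' (by rintro _ ⟨S, rfl, hS⟩; exact h S hS)

theorem EntangledStates.isColexAntichain {M : PDFA α σ} {S : Set σ} (h : M.EntangledStates S) :
    M.IsColexAntichain S := by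
  obtain ⟨x, hx, hmono, hvisit⟩ := h
  have key : ∀ q₁ ∈ S, ∀ q₂ ∈ S, ¬ M.stateLt q₁ q₂ := by
    rintro q₁ h₁ q₂ h₂ ⟨-, hlt⟩
    rcases hmono with hmono | hmono
    · obtain ⟨i, -, hi⟩ := hvisit q₂ h₂ 0
      obtain ⟨j, hij, hj⟩ := hvisit q₁ h₁ i
      exact absurd (hmono i j hij) (not_le.2 (hlt _ ⟨hx j, hj⟩ _ ⟨hx i, hi⟩))
    · obtain ⟨i, -, hi⟩ := hvisit q₁ h₁ 0
      obtain ⟨j, hij, hj⟩ := hvisit q₂ h₂ i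
      exact absurd (hmono i j hij) (not_le.2 (hlt _ ⟨hx i, hi⟩ _ ⟨hx j, hj⟩))
  exact fun q₁ h₁ q₂ h₂ _ => ⟨key q₁ h₁ q₂ h₂, key q₂ h₂ q₁ h₁⟩

theorem ent_le_width (M : PDFA α σ) [Fintype σ] : M.ent ≤ M.width :=
  M.ent_le fun S hS =>
    le_csSup (bddAbove_card fun S : Finset σ => M.IsColexAntichain ↑S) ⟨S, rfl, hS.isColexAntichain⟩

/-- The minimum automaton has the least entanglement number. -/
theorem Trim.ent_le_of_minimum [Fintype σ] [Fintype τ] {A : PDFA α σ} (hA : A.Trim)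
    (hmin : ∀ (m : ℕ) (D : PDFA α (Fin m)), D.Trim → D.language = A.language →
      Fintype.card σ ≤ m)
    {B : PDFA α τ} (hBL : B.language = A.language) : A.ent ≤ B.ent := by
  classical
  refine A.ent_le fun S hS => ?_
  obtain ⟨x, hx, hmono, hvisit⟩ := hS
  have hpig : ∀ q : S, ∃ p : τ, ∀ n, ∃ i, n ≤ i ∧ A.eval (x i) = some q.1 ∧
      B.eval (x i) = some p := by
    intro q
    by_contra! hcon
    choose N hN using hcon
    obtain ⟨i, hi, hiq⟩ := hvisit q.1 q.2 (Finset.univ.sup N)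
    have hxi : x i ∈ B.prefLang := prefLang_congr hBL ▸ hx i
    obtain ⟨p, hp⟩ := exists_eval_of_mem_prefLang hxi
    exact hN p i ((Finset.le_sup (Finset.mem_univ p)).trans hi) hiq hp
  choose p hp using hpig
  have hinj : Function.Injective p := by
    intro q q' hqq
    obtain ⟨i, -, hi, hi'⟩ := hp q 0
    obtain ⟨j, -, hj, hj'⟩ := hp q' 0
    have hB : B.eval (x i) = B.eval (x j) := by rw [hi', hj', hqq]
    have := hA.eval_eq_of_minimum hmin (hx i) (hx j) fun w => hBL ▸ mem_language_congr hB w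
    rw [hi, hj] at this
    exact Subtype.ext (Option.some.inj this)
  have hcard : (Finset.univ.image p).card = S.card := by
    rw [Finset.card_image_of_injective _ hinj, Finset.card_univ, Fintype.card_coe]
  rw [← hcard]
  refine B.card_le_ent ⟨x, fun i => prefLang_congr hBL ▸ hx i, hmono, ?_⟩
  intro r hr n
  simp only [Finset.coe_image, Finset.coe_univ, Set.image_univ, Set.mem_range] at hr
  obtain ⟨q, rfl⟩ := hr
  obtain ⟨i, hi, -, hi'⟩ := hp q n
  exact ⟨i, hi, hi'⟩

theorem cons_le_cons_iff_of_linearOrder {a b : α} {u v : List α} :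
    a :: u ≤ b :: v ↔ a < b ∨ (a = b ∧ u ≤ v) := by
  rw [← not_lt, List.cons_lt_cons_iff, ← not_lt]
  rcases lt_trichotomy a b with h | h | h
  · simp [h, h.ne', h.not_gt]
  · simp [h]
  · simp [h, h.ne', h.not_gt]

theorem exists_eq_cons_of_mem_Icc {M : PDFA α σ} {a : α} {y z y' : M.RevPref} {u v : List α}
    (hy : y.1 = a :: u) (hy' : y'.1 = a :: v) (hz : z ∈ Set.Icc y y') :
    ∃ x : M.RevPref, z.1 = a :: x.1 ∧ u ≤ x.1 ∧ x.1 ≤ v := by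
  obtain ⟨h1, h2⟩ := hz
  rw [← Subtype.coe_le_coe, hy] at h1
  rw [← Subtype.coe_le_coe, hy'] at h2
  obtain ⟨z, hz⟩ := z
  cases z with
  | nil => exact absurd h1 (not_le.2 List.Lex.nil)
  | cons b w =>
    rw [cons_le_cons_iff_of_linearOrder] at h1 h2
    have hab : a = b := by
      rcases h1 with h1 | ⟨h1, -⟩
      · rcases h2 with h2 | ⟨h2, -⟩
        · exact absurd h1 h2.asymm
        · exact h2.symm
      · exact h1
    subst hab
    rw [List.reverse_cons] at hz
    exact ⟨⟨w, prefLang_of_append hz⟩, rfl, by simpa using h1, by simpa using h2⟩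

theorem Trim.entConvex_consImage {M : PDFA α σ} (hM : M.Trim) {a : α} {D : Set M.RevPref}
    (hne : (M.consImage a D).Nonempty) (hD : EntConvex M.colour D) :
    EntConvex M.colour (M.consImage a D) := by
  refine ⟨⟨?_⟩, hD.recurrent.imp (hM.recurrent_consImage hne ?_) (hM.recurrent_consImage hne ?_)⟩
  · rintro y ⟨x, hx, hy⟩ y' ⟨x', hx', hy'⟩ z hz
    obtain ⟨w, hw, h1, h2⟩ := exists_eq_cons_of_mem_Icc hy hy' hz
    exact ⟨w, hD.ordConnected.out hx hx' ⟨h1, h2⟩, hw⟩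
  · intro x x' y y' hy hy' h
    rw [← Subtype.coe_le_coe] at h ⊢
    rw [hy, hy']
    exact List.cons_le_cons a h
  · intro x x' y y' hy hy' h
    rw [ge_iff_le, ← Subtype.coe_le_coe] at h ⊢
    rw [hy, hy']
    exact List.cons_le_cons a h

/-- Linked prefixes stay linked after appending a letter. -/
theorem Trim.linked_cons {M : PDFA α σ} (hM : M.Trim) {a : α} {u v : M.RevPref}
    (h : Linked M.colour u v) (hu : (a :: u.1).reverse ∈ M.prefLang)
    (hv : (a :: v.1).reverse ∈ M.prefLang) :
    Linked M.colour (⟨a :: u.1, hu⟩ : M.RevPref) ⟨a :: v.1, hv⟩ := by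
  obtain ⟨hc, F, hF, hD, hs⟩ := h
  refine ⟨colour_cons hc hu hv, M.consImage a '' F, hF.image _, ?_, ?_⟩
  · rintro _ ⟨D, hDF, rfl⟩
    obtain ⟨hent, z, hz, hzc⟩ := hD D hDF
    have hz' := hM.cons_mem_prefLang hzc.symm hu
    have hmem : (⟨a :: z.1, hz'⟩ : M.RevPref) ∈ M.consImage a D := ⟨z, hz, rfl⟩
    exact ⟨hM.entConvex_consImage ⟨_, hmem⟩ hent, _, hmem, colour_cons hzc hz' hu⟩
  · intro y hy
    have hx : ∃ x ∈ Set.uIcc u v, y.1 = a :: x.1 := by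
      rw [Set.mem_uIcc] at hy
      rcases hy with hy | hy
      · obtain ⟨x, hx, h1, h2⟩ := exists_eq_cons_of_mem_Icc rfl rfl hy
        exact ⟨x, Set.mem_uIcc.2 (Or.inl ⟨h1, h2⟩), hx⟩
      · obtain ⟨x, hx, h1, h2⟩ := exists_eq_cons_of_mem_Icc rfl rfl hy
        exact ⟨x, Set.mem_uIcc.2 (Or.inr ⟨h1, h2⟩), hx⟩
    obtain ⟨x, hx, hyx⟩ := hx
    obtain ⟨D, hDF, hxD⟩ := hs hx
    exact ⟨_, ⟨D, hDF, rfl⟩, x, hxD, hyx⟩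

/-- Some trim automaton for the language has width at most the entanglement number of `A`. -/
theorem Trim.exists_width_le_ent [Fintype σ] {A : PDFA α σ} (hA : A.Trim) :
    ∃ (m : ℕ) (B : PDFA α (Fin m)), B.Trim ∧ B.language = A.language ∧ B.width ≤ A.ent := by
  classical
  have : Finite (Quotient (linkedSetoid A.colour)) := finite_quotient_linked A.colour
  let e := Finite.equivFin (Quotient (linkedSetoid A.colour))
  let f : A.prefLang → Fin _ := fun w => e (Quotient.mk _ (A.toRev w))
  have hlink : ∀ u v, f u = f v ↔ Linked A.colour (A.toRev u) (A.toRev v) := fun u v =>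
    e.injective.eq_iff.trans Quotient.eq
  have htoRev : Function.Surjective A.toRev := fun r => ⟨⟨r.1.reverse, r.2⟩, by simp [toRev]⟩
  have heval : ∀ u v, f u = f v → A.eval u.1 = A.eval v.1 := fun u v h => by
    simpa only [colour_toRev] using ((hlink u v).1 h).1
  obtain ⟨B, hB, hBL, hBe⟩ := A.exists_of_labelling hA.nil_mem_prefLang f
    (e.surjective.comp (Quotient.mk_surjective.comp htoRev))
    (fun u v h hu => by
      simpa using (mem_language_congr (heval u v h) []).1 (by simpa using hu))
    (fun u v h a hu => by
      have hv : v.1 ++ [a] ∈ A.prefLang :=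
        hA.mem_prefLang_congr (by rw [eval_concat, eval_concat, heval u v h]) hu
      refine ⟨hv, (hlink _ _).2 ?_⟩
      have := hA.linked_cons (a := a) ((hlink u v).1 h) (by simpa [toRev] using hu)
        (by simpa [toRev] using hv)
      simpa only [toRev, List.reverse_append, List.reverse_singleton, List.singleton_append]
        using this)
  refine ⟨_, B, hB, hBL, csSup_le' ?_⟩
  rintro _ ⟨S, rfl, hS⟩
  rcases S.eq_empty_or_nonempty with rfl | hne
  · simp
  have : Nonempty S := hne.to_subtype
  have hI : ∀ q w, w ∈ B.I q ↔ ∃ h : w ∈ A.prefLang, f ⟨w, h⟩ = q := by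
    intro q w
    rw [I, Set.mem_ofPred_eq, hBe, prefLang_congr hBL]
    exact ⟨fun h => h.2, fun h => ⟨h.1, h⟩⟩
  have hrep : ∀ q : S, ∃ w : A.prefLang, f w = q.1 := fun q =>
    (e.surjective.comp (Quotient.mk_surjective.comp htoRev)) q.1
  choose rep hrep using hrep
  have hinter : ∀ p q : S, ∃ u, Linked A.colour (A.toRev (rep p)) u ∧
      ∃ v, Linked A.colour (A.toRev (rep q)) v ∧ v ≤ u := by
    intro p q
    by_cases hpq : p = q
    · subst hpq
      exact ⟨_, Linked.refl _ _, _, Linked.refl _ _, le_rfl⟩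
    have hpq' : p.1 ≠ q.1 := fun h => hpq (Subtype.ext h)
    have hnot := (hS p.1 p.2 q.1 q.2 hpq').1
    simp only [stateLt, not_and, not_forall, not_lt] at hnot
    obtain ⟨u, hu, v, hv, hvu⟩ := hnot hpq'
    obtain ⟨hu, hup⟩ := (hI _ _).1 hu
    obtain ⟨hv, hvq⟩ := (hI _ _).1 hv
    exact ⟨A.toRev ⟨u, hu⟩, (hlink _ _).1 ((hrep p).trans hup.symm),
      A.toRev ⟨v, hv⟩, (hlink _ _).1 ((hrep q).trans hvq.symm), hvu⟩
  obtain ⟨x, hx, hvisit⟩ := exists_sequence_of_interleaved _ hinter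
  have hstate : ∀ q : S, ∃ s, A.eval (rep q).1 = some s := fun q =>
    exists_eval_of_mem_prefLang (rep q).2
  choose s hs using hstate
  have hinj : Function.Injective s := by
    intro p q hpq
    obtain ⟨u, hu, v, hv, hvu⟩ := hinter p q
    obtain ⟨v', hv', u', hu', huv⟩ := hinter q p
    have hc : A.colour u = A.colour v := by
      rw [← hu.1, ← hv.1, colour_toRev, colour_toRev, hs, hs, hpq]
    have huv' := linked_of_interleaved (hu.symm.trans hu') (hv.symm.trans hv') hc hvu huv
    have := (hlink _ _).2 (hu.trans (huv'.trans hv.symm))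
    rw [hrep, hrep] at this
    exact Subtype.ext this
  have hcard : (Finset.univ.image s).card = S.card := by
    rw [Finset.card_image_of_injective _ hinj, Finset.card_univ, Fintype.card_coe]
  rw [← hcard]
  refine A.card_le_ent ⟨fun i => (x i).1.reverse, fun i => (x i).2, ?_, ?_⟩
  · refine hx.imp (fun hx i j hij => ?_) (fun hx i j hij => ?_)
    · simpa using hx hij
    · simpa using hx hij
  · intro r hr n
    simp only [Finset.coe_image, Finset.coe_univ, Set.image_univ, Set.mem_range] at hr
    obtain ⟨q, rfl⟩ := hr
    obtain ⟨i, hi, hi'⟩ := hvisit q n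
    exact ⟨i, hi, hi'.trans ((colour_toRev _ _).trans (hs q))⟩

end PDFA

/-- Theorem: if `A` is the minimum DFA of the regular language `L`, then
`width(L) = ent(A) = ent(L)`. -/
theorem width_lang_eq_ent_min_dfa {α σ : Type*} [LinearOrder α] [Fintype σ]
    (A : PDFA α σ) (hA : A.Trim)
    (hmin : ∀ (m : ℕ) (D : PDFA α (Fin m)), D.Trim → D.language = A.language →
      Fintype.card σ ≤ m) :
    langWidth A.language = A.ent ∧ A.ent = langEnt A.language := by
  obtain ⟨m, B, hB, hBL, hBw⟩ := hA.exists_width_le_ent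
  have hle : A.ent ≤ B.ent := hA.ent_le_of_minimum hmin hBL
  have hw : B.width = A.ent := le_antisymm hBw (hle.trans B.ent_le_width)
  have he : B.ent = A.ent := le_antisymm (B.ent_le_width.trans hBw) hle
  constructor
  · refine le_antisymm (Nat.sInf_le ⟨m, B, hB, hBL, hw⟩) (le_csInf ⟨_, m, B, hB, hBL, hw⟩ ?_)
    rintro _ ⟨k, D, -, hDL, rfl⟩
    exact (hA.ent_le_of_minimum hmin hDL).trans D.ent_le_width
  · refine le_antisymm (le_csInf ⟨_, m, B, hB, hBL, he⟩ ?_) (Nat.sInf_le ⟨m, B, hB, hBL, he⟩)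
    rintro _ ⟨k, D, -, hDL, rfl⟩
    exact hA.ent_le_of_minimum hmin hDL
end

section
/- Let L ⊆ Σ* be a nonempty language, P a partition of Pref(L), and ∼ an equivalence relation on Pref(L) that respects Pref(L). Then there exists a unique coarsest P-consistent, P-convex, right-invariant equivalence relation refining ∼ (i.e., a P-consistent, P-convex, right-invariant refinement of ∼ that is refined by every P-consistent, P-convex, right-invariant equivalence relation refining ∼). -/
/-- `Pref(L)`: the set of prefixes of words of `L`. -/
def PrefSet {α : Type*} (L : Set (List α)) : Set (List α) :=
  {w | ∃ v, w ++ v ∈ L}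

/-- `r` is an equivalence relation on the set `S` of words. -/
def IsEquivOn {α : Type*} (S : Set (List α)) (r : List α → List α → Prop) : Prop :=
  (∀ u v, r u v → u ∈ S ∧ v ∈ S) ∧ (∀ u ∈ S, r u u) ∧
  (∀ u v, r u v → r v u) ∧ (∀ u v w, r u v → r v w → r u w)

/-- `r` respects `Pref(L)`: equivalent words have the same right extensions inside `Pref(L)`. -/
def Respects {α : Type*} (L : Set (List α)) (r : List α → List α → Prop) : Prop :=
  ∀ u v φ, r u v → u ++ φ ∈ PrefSet L → v ++ φ ∈ PrefSet L

/-- `r` is right-invariant: it respects `Pref(L)` and is preserved under right extensions. -/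
def RightInvariant {α : Type*} (L : Set (List α)) (r : List α → List α → Prop) : Prop :=
  ∀ u v φ, r u v → u ++ φ ∈ PrefSet L →
    v ++ φ ∈ PrefSet L ∧ r (u ++ φ) (v ++ φ)

/-- `r` is `P`-consistent: equivalent words lie in the same element of the partition `P`. -/
def PConsistent {α : Type*} (P : Set (Set (List α))) (r : List α → List α → Prop) : Prop :=
  ∀ u v, r u v → ∀ U ∈ P, u ∈ U → v ∈ U

/-- `r` is `P`-convex: each class `[u]_r` is convex in `(U_u, ⪯)` for the co-lex order. -/
def PConvex {α : Type*} [LinearOrder α] (P : Set (Set (List α)))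
    (r : List α → List α → Prop) : Prop :=
  ∀ u v w, r u w → ∀ U ∈ P, u ∈ U → v ∈ U →
    min u.reverse w.reverse ≤ v.reverse → v.reverse ≤ max u.reverse w.reverse → r u v

/-- `P` is a partition of the set `S`. -/
def IsPartitionOf {α : Type*} (S : Set (List α)) (P : Set (Set (List α))) : Prop :=
  (∀ U ∈ P, U.Nonempty) ∧ (⋃₀ P = S) ∧ P.Pairwise Disjoint

/-- `s` is a `P`-consistent, `P`-convex, right-invariant equivalence relation refining `r`. -/
def IsAdmissibleRefinement {α : Type*} [LinearOrder α] (L : Set (List α))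
    (P : Set (Set (List α))) (r s : List α → List α → Prop) : Prop :=
  IsEquivOn (PrefSet L) s ∧ (∀ u v, s u v → r u v) ∧
    PConsistent P s ∧ PConvex P s ∧ RightInvariant L s

/-- The join of all admissible refinements of `r`. -/
def admissibleJoin {α : Type*} [LinearOrder α] (L : Set (List α))
    (P : Set (Set (List α))) (r : List α → List α → Prop) : List α → List α → Prop :=
  Relation.TransGen fun u v => ∃ s, IsAdmissibleRefinement L P r s ∧ s u v

theorem between_or_between {β : Type*} [LinearOrder β] {a b c x : β}
    (h₁ : min a c ≤ x) (h₂ : x ≤ max a c) :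
    (min a b ≤ x ∧ x ≤ max a b) ∨ (min b c ≤ x ∧ x ≤ max b c) := by
  simp only [min_le_iff, le_max_iff] at *
  rcases le_total b x with h | h <;> tauto

section

variable {α : Type*} [LinearOrder α] {L : Set (List α)} {P : Set (Set (List α))}
  {r : List α → List α → Prop}

theorem isAdmissibleRefinement_eqOn (hr : IsEquivOn (PrefSet L) r) :
    IsAdmissibleRefinement L P r fun u v => u ∈ PrefSet L ∧ u = v := by
  refine ⟨⟨?_, ?_, ?_, ?_⟩, ?_, ?_, ?_, ?_⟩
  · rintro u v ⟨hu, rfl⟩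
    exact ⟨hu, hu⟩
  · exact fun u hu => ⟨hu, rfl⟩
  · rintro u v ⟨hu, rfl⟩
    exact ⟨hu, rfl⟩
  · rintro u v w ⟨hu, rfl⟩ h
    exact h
  · rintro u v ⟨hu, rfl⟩
    exact hr.2.1 u hu
  · rintro u v ⟨-, rfl⟩ U - h
    exact h
  · rintro u v w ⟨hu, rfl⟩ U - - - h₁ h₂
    rw [min_self] at h₁
    rw [max_self] at h₂
    exact ⟨hu, List.reverse_injective (le_antisymm h₁ h₂)⟩
  · rintro u v φ ⟨-, rfl⟩ h
    exact ⟨h, h, rfl⟩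

theorem isEquivOn_admissibleJoin (hr : IsEquivOn (PrefSet L) r) :
    IsEquivOn (PrefSet L) (admissibleJoin L P r) := by
  refine ⟨fun u v h => ?_, fun u hu => ?_, fun u v h => ?_, fun u v w => .trans⟩
  · induction h with
    | single h =>
      obtain ⟨s, hs, h⟩ := h
      exact hs.1.1 _ _ h
    | tail _ h ih =>
      obtain ⟨s, hs, h⟩ := h
      exact ⟨ih.1, (hs.1.1 _ _ h).2⟩
  · exact .single ⟨_, isAdmissibleRefinement_eqOn hr, hu, rfl⟩
  · induction h with
    | single h =>
      obtain ⟨s, hs, h⟩ := h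
      exact .single ⟨s, hs, hs.1.2.2.1 _ _ h⟩
    | tail _ h ih =>
      obtain ⟨s, hs, h⟩ := h
      exact .head ⟨s, hs, hs.1.2.2.1 _ _ h⟩ ih

theorem admissibleJoin_le (hr : IsEquivOn (PrefSet L) r) {u v : List α}
    (h : admissibleJoin L P r u v) : r u v := by
  induction h with
  | single h =>
    obtain ⟨s, hs, h⟩ := h
    exact hs.2.1 _ _ h
  | tail _ h ih =>
    obtain ⟨s, hs, h⟩ := h
    exact hr.2.2.2 _ _ _ ih (hs.2.1 _ _ h)

theorem pConsistent_admissibleJoin : PConsistent P (admissibleJoin L P r) := by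
  intro u v h U hU hu
  induction h with
  | single h =>
    obtain ⟨s, hs, h⟩ := h
    exact hs.2.2.1 _ _ h U hU hu
  | tail _ h ih =>
    obtain ⟨s, hs, h⟩ := h
    exact hs.2.2.1 _ _ h U hU ih

theorem pConvex_admissibleJoin : PConvex P (admissibleJoin L P r) := by
  intro u v w h U hU hu hv h₁ h₂
  induction h with
  | single h =>
    obtain ⟨s, hs, h⟩ := h
    exact .single ⟨s, hs, hs.2.2.2.1 _ _ _ h U hU hu hv h₁ h₂⟩
  | @tail b c hb h ih =>
    obtain ⟨s, hs, h⟩ := h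
    rcases between_or_between (b := b.reverse) h₁ h₂ with ⟨h₁, h₂⟩ | ⟨h₁, h₂⟩
    · exact ih h₁ h₂
    · have hbU : b ∈ U := pConsistent_admissibleJoin u b hb U hU hu
      exact .tail hb ⟨s, hs, hs.2.2.2.1 _ _ _ h U hU hbU hv h₁ h₂⟩

theorem rightInvariant_admissibleJoin : RightInvariant L (admissibleJoin L P r) := by
  intro u v φ h hu
  induction h with
  | single h =>
    obtain ⟨s, hs, h⟩ := h
    obtain ⟨hv, h⟩ := hs.2.2.2.2 _ _ φ h hu
    exact ⟨hv, .single ⟨s, hs, h⟩⟩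
  | tail _ h ih =>
    obtain ⟨s, hs, h⟩ := h
    obtain ⟨hv, h⟩ := hs.2.2.2.2 _ _ φ h ih.1
    exact ⟨hv, .tail ih.2 ⟨s, hs, h⟩⟩

end

/-- Corollary: every equivalence relation on `Pref(L)` respecting `Pref(L)` admits a
unique coarsest `P`-consistent, `P`-convex, right-invariant refinement. -/
theorem exists_unique_coarsest_refinement {α : Type*} [LinearOrder α]
    (L : Set (List α)) (hL : L.Nonempty)
    (P : Set (Set (List α))) (hP : IsPartitionOf (PrefSet L) P)
    (r : List α → List α → Prop) (hr : IsEquivOn (PrefSet L) r)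
    (hresp : Respects L r) :
    ∃ s : List α → List α → Prop,
      (IsEquivOn (PrefSet L) s ∧ (∀ u v, s u v → r u v) ∧
        PConsistent P s ∧ PConvex P s ∧ RightInvariant L s ∧
        (∀ s' : List α → List α → Prop,
          IsEquivOn (PrefSet L) s' → (∀ u v, s' u v → r u v) →
          PConsistent P s' → PConvex P s' → RightInvariant L s' →
          ∀ u v, s' u v → s u v)) ∧
      (∀ s'' : List α → List α → Prop,
        (IsEquivOn (PrefSet L) s'' ∧ (∀ u v, s'' u v → r u v) ∧
          PConsistent P s'' ∧ PConvex P s'' ∧ RightInvariant L s'' ∧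
          (∀ s' : List α → List α → Prop,
            IsEquivOn (PrefSet L) s' → (∀ u v, s' u v → r u v) →
            PConsistent P s' → PConvex P s' → RightInvariant L s' →
            ∀ u v, s' u v → s'' u v)) →
        ∀ u v, s'' u v ↔ s u v) := by
  have hmax : ∀ s' : List α → List α → Prop,
      IsEquivOn (PrefSet L) s' → (∀ u v, s' u v → r u v) →
      PConsistent P s' → PConvex P s' → RightInvariant L s' →
      ∀ u v, s' u v → admissibleJoin L P r u v :=
    fun s' h₁ h₂ h₃ h₄ h₅ u v h => .single ⟨s', ⟨h₁, h₂, h₃, h₄, h₅⟩, h⟩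
  refine ⟨admissibleJoin L P r, ⟨isEquivOn_admissibleJoin hr, fun u v => admissibleJoin_le hr,
    pConsistent_admissibleJoin, pConvex_admissibleJoin, rightInvariant_admissibleJoin, hmax⟩, ?_⟩
  rintro s ⟨h₁, h₂, h₃, h₄, h₅, hs⟩ u v
  exact ⟨hmax s h₁ h₂ h₃ h₄ h₅ u v, hs _ (isEquivOn_admissibleJoin hr)
    (fun u v => admissibleJoin_le hr) pConsistent_admissibleJoin pConvex_admissibleJoin
    rightInvariant_admissibleJoin u v⟩
end
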